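/- arXiv:2008.12836 — 6 statements merged into one kernel-verified Lean document; each statement's English description precedes it below -/
import Mathlib

section
/- In the net tower setup, for every integer k ∈ ℤ one has X = ⋃_{x ∈ N_k} B(x, (1−a^{-1})^{-1}·a^{-k}). In particular, the distance from any point of X to the set N_k is less than (1−a^{-1})^{-1}·a^{-k} for every k ∈ ℤ. -/
open Metric Set Filter Topology
open scoped ENNReal

noncomputable section

/-- A metric space `(X,d)` is `K`-doubling: every ball of radius `r` can be covered by at most
`K` balls of radius `r/2`. -/
def IsDoublingWith (X : Type*) [PseudoMetricSpace X] (K : ℝ) : Prop :=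
  ∀ (x : X) (r : ℝ), 0 < r → ∃ t : Finset X, (t.card : ℝ) ≤ K ∧
    Metric.ball x r ⊆ ⋃ y ∈ t, Metric.ball y (r / 2)

/-- A metric space `(X,d)` is `K`-uniformly perfect. -/
def IsUniformlyPerfectWith (X : Type*) [PseudoMetricSpace X] (K : ℝ) : Prop :=
  ∀ (x : X) (r : ℝ), 0 < r → ((Metric.ball x r)ᶜ).Nonempty →
    (Metric.ball x r \ Metric.ball x (r / K)).Nonempty

/-- `N` is an `ε`-net in the subspace `Y` of `X`: `N ⊆ Y`, `N` is `ε`-separated, and `N` is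
maximal among `ε`-separated subsets of `Y`. -/
def IsNetIn (X : Type*) [PseudoMetricSpace X] (ε : ℝ) (N Y : Set X) : Prop :=
  N ⊆ Y ∧ (∀ x ∈ N, ∀ y ∈ N, x ≠ y → ε ≤ dist x y) ∧
    ∀ M : Set X, N ⊆ M → M ⊆ Y →
      (∀ x ∈ M, ∀ y ∈ M, x ≠ y → ε ≤ dist x y) → M = N

/-- A net tower on `(X,d)` with parameter `a`: a base point `x₀`, an `a⁻ᵏ`-net `N k` in `X` for
every integer `k ≥ 0` (nested, with `x₀ ∈ N 0`), an `a⁻ᵏ`-net `N k` in the subspace `N (k+1)`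
(containing `x₀`) for `k < 0`, and a choice `P k x ∈ N (k-1)` of a nearest point of `N (k-1)`
to each `x ∈ N k` (a predecessor). -/
structure NetTower (X : Type*) [MetricSpace X] (a : ℝ) where
  x₀ : X
  N : ℤ → Set X
  isNet_nonneg : ∀ k : ℤ, 0 ≤ k → IsNetIn X (a ^ (-k)) (N k) Set.univ
  nested : ∀ k : ℤ, 0 ≤ k → N k ⊆ N (k + 1)
  x₀_mem : ∀ k : ℤ, k ≤ 0 → x₀ ∈ N k
  isNet_neg : ∀ k : ℤ, k < 0 → IsNetIn X (a ^ (-k)) (N k) (N (k + 1))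
  P : ℤ → X → X
  P_mem : ∀ k : ℤ, ∀ x ∈ N k, P k x ∈ N (k - 1)
  P_nearest : ∀ k : ℤ, ∀ x ∈ N k, ∀ z ∈ N (k - 1), dist x (P k x) ≤ dist x z

namespace NetTower

variable {X : Type*} [MetricSpace X] {a : ℝ}

/-- `iterP T j l z`: the `j`-fold iterated predecessor `P^j(z)` of `z ∈ N l`
(which lies in `N (l - j)`). -/
def iterP (T : NetTower X a) : ℕ → ℤ → X → X
  | 0, _, z => z
  | j + 1, l, z => iterP T j (l - 1) (T.P l z)

/-- The descendants `D_k(y) = {y} ∪ {z ∈ N_l : l > k, P^{l-k}(z) = y}` of `y ∈ N k`. -/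
def D (T : NetTower X a) (k : ℤ) (y : X) : Set X :=
  {y} ∪ {z : X | ∃ l : ℤ, k < l ∧ z ∈ T.N l ∧ T.iterP (l - k).toNat l z = y}

end NetTower

theorem isNetIn_cover {X : Type*} [PseudoMetricSpace X] {ε : ℝ} (hε : 0 < ε) {N Y : Set X}
    (h : IsNetIn X ε N Y) {y : X} (hy : y ∈ Y) : ∃ x ∈ N, dist y x < ε := by
  obtain ⟨h1, h2, h3⟩ := h
  by_contra! hc
  have hM : insert y N = N := by
    apply h3 _ (Set.subset_insert _ _) (Set.insert_subset hy h1)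
    rintro u (rfl | hu) v (rfl | hv) huv
    · exact absurd rfl huv
    · exact hc v hv
    · rw [dist_comm]; exact hc u hu
    · exact h2 u hu v hv huv
  have hyN : y ∈ N := hM ▸ Set.mem_insert y N
  have := hc y hyN
  rw [dist_self] at this
  linarith

/-- Lemma 3.14(a) (covering property of the net tower): for every `k ∈ ℤ`, the balls of radius
`(1−a⁻¹)⁻¹ a⁻ᵏ` centered at the points of `N k` cover `X`; in particular every point of `X`
is at distance `< (1−a⁻¹)⁻¹ a⁻ᵏ` from `N k`. -/
theorem netTower_cover
    (X : Type) [MetricSpace X] [CompleteSpace X]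
    (KD KP a : ℝ) (hKD : 1 ≤ KD) (hKP : 1 < KP) (ha : 8 < a)
    (hdoub : IsDoublingWith X KD) (hperf : IsUniformlyPerfectWith X KP)
    (hdiam : EMetric.diam (Set.univ : Set X) = ENNReal.ofReal (1 / 2) ∨
      EMetric.diam (Set.univ : Set X) = ⊤)
    (T : NetTower X a) :
    (∀ (k : ℤ) (y : X), ∃ x ∈ T.N k, dist y x < (1 - a⁻¹)⁻¹ * a ^ (-k)) ∧
      ∀ (k : ℤ) (y : X), Metric.infDist y (T.N k) < (1 - a⁻¹)⁻¹ * a ^ (-k) := by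
  have ha0 : 0 < a := by linarith
  have hia : a⁻¹ < 1 := inv_lt_one_of_one_lt₀ (by linarith)
  have hia0 : 0 < a⁻¹ := inv_pos.mpr ha0
  have hC1 : 1 ≤ (1 - a⁻¹)⁻¹ := (one_le_inv₀ (by linarith)).mpr (by linarith)
  have hC : (1 - a⁻¹)⁻¹ = 1 + a⁻¹ * (1 - a⁻¹)⁻¹ := by
    have h := mul_inv_cancel₀ (show (1 - a⁻¹) ≠ 0 by linarith)
    linarith
  have hnn : ∀ k : ℤ, 0 ≤ k → ∀ y : X, ∃ x ∈ T.N k, dist y x < (1 - a⁻¹)⁻¹ * a ^ (-k) := by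
    intro k hk y
    have hp : 0 < a ^ (-k) := zpow_pos ha0 _
    obtain ⟨x, hx, hd⟩ := isNetIn_cover hp (T.isNet_nonneg k hk) (Set.mem_univ y)
    exact ⟨x, hx, hd.trans_le (le_mul_of_one_le_left hp.le hC1)⟩
  have hneg : ∀ n : ℕ, ∀ y : X, ∃ x ∈ T.N (-(n : ℤ)),
      dist y x < (1 - a⁻¹)⁻¹ * a ^ (-(-(n : ℤ))) := by
    intro n
    induction n with
    | zero => exact hnn _ (by simp)
    | succ n ih =>
      intro y
      obtain ⟨x', hx', hd'⟩ := ih y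
      have hk : (-((n + 1 : ℕ) : ℤ)) < 0 := by push_cast; omega
      have hp : 0 < a ^ (-(-((n + 1 : ℕ) : ℤ))) := zpow_pos ha0 _
      have he : -((n + 1 : ℕ) : ℤ) + 1 = -(n : ℤ) := by push_cast; ring
      obtain ⟨x, hx, hd⟩ := isNetIn_cover hp (T.isNet_neg _ hk) (y := x') (by rw [he]; exact hx')
      refine ⟨x, hx, ?_⟩
      have hpow : a ^ (-(-(n : ℤ))) = a⁻¹ * a ^ (-(-((n + 1 : ℕ) : ℤ))) := by
        simp only [neg_neg, zpow_natCast, pow_succ]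
        field_simp
      rw [hpow] at hd'
      generalize a ^ (-(-((n + 1 : ℕ) : ℤ))) = q at *
      calc dist y x ≤ dist y x' + dist x' x := dist_triangle _ _ _
        _ < (1 - a⁻¹)⁻¹ * (a⁻¹ * q) + q := add_lt_add hd' hd
        _ = (1 + a⁻¹ * (1 - a⁻¹)⁻¹) * q := by ring
        _ = (1 - a⁻¹)⁻¹ * q := by rw [← hC]
  have hall : ∀ (k : ℤ) (y : X), ∃ x ∈ T.N k, dist y x < (1 - a⁻¹)⁻¹ * a ^ (-k) := by
    intro k y
    rcases le_total 0 k with hk | hk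
    · exact hnn k hk y
    · obtain ⟨n, hn⟩ := Int.exists_eq_neg_ofNat hk
      subst hn
      exact hneg n y
  refine ⟨hall, fun k y => ?_⟩
  obtain ⟨x, hx, hd⟩ := hall k y
  exact (Metric.infDist_le_dist_of_mem hx).trans_lt hd
end
end

section
/- In the net tower setup, assume moreover that λ ≥ 32 and a ≥ 24·max(λ,K_P). Let k ∈ ℤ and let y ∈ N_{k+1} be such that B(y, (1−a^{-1})^{-1}·a^{-k-1}) ∩ B(P(y), a^{-k}/3) ≠ ∅. Then for every z ∈ N_{k+1} with d(y,z) < 2·(1−a^{-1})^{-1}·a^{-k-1}, one has P(z) = P(y). -/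
open Metric Set Filter Topology
open scoped ENNReal

noncomputable section

/-- Lemma 3.14(b): if `λ ≥ 32` and `a ≥ 24·max(λ,K_P)`, and `y ∈ N_{k+1}` is such that
`B(y,(1−a⁻¹)⁻¹a^{-k-1})` meets `B(P(y), a⁻ᵏ/3)`, then every `z ∈ N_{k+1}` with
`d(y,z) < 2(1−a⁻¹)⁻¹a^{-k-1}` has the same predecessor as `y`. -/
theorem netTower_same_predecessor
    (X : Type) [MetricSpace X] [CompleteSpace X]
    (KD KP a lam : ℝ) (hKD : 1 ≤ KD) (hKP : 1 < KP) (ha : 8 < a)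
    (hlam : 32 ≤ lam) (ha' : 24 * max lam KP ≤ a)
    (hdoub : IsDoublingWith X KD) (hperf : IsUniformlyPerfectWith X KP)
    (hdiam : EMetric.diam (Set.univ : Set X) = ENNReal.ofReal (1 / 2) ∨
      EMetric.diam (Set.univ : Set X) = ⊤)
    (T : NetTower X a)
    (k : ℤ) (y : X) (hy : y ∈ T.N (k + 1))
    (hnear : (Metric.ball y ((1 - a⁻¹)⁻¹ * a ^ (-(k + 1))) ∩
      Metric.ball (T.P (k + 1) y) (a ^ (-k) / 3)).Nonempty) :
    ∀ z ∈ T.N (k + 1), dist y z < 2 * (1 - a⁻¹)⁻¹ * a ^ (-(k + 1)) →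
      T.P (k + 1) z = T.P (k + 1) y := by
  have ha768 : 768 ≤ a := by
    have := le_max_left lam KP
    linarith
  have ha0 : (0:ℝ) < a := by linarith
  have hs : 0 < a ^ (-k) := zpow_pos ha0 _
  have hr : (1 - a⁻¹)⁻¹ * a ^ (-(k + 1)) = a ^ (-k) / (a - 1) := by
    have e : a ^ (-(k + 1)) = a ^ (-k) / a := by
      rw [show -(k + 1) = -k - 1 by ring, zpow_sub_one₀ ha0.ne', div_eq_mul_inv]
    have h1 : a - 1 ≠ 0 := by linarith
    have h2 : 1 - a⁻¹ = (a - 1) / a := by field_simp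
    rw [e, h2]
    field_simp
  have hsmall : a ^ (-k) / (a - 1) ≤ a ^ (-k) / 18 :=
    div_le_div_of_nonneg_left hs.le (by norm_num) (by linarith)
  intro z hz hyz
  rw [mul_assoc, hr] at hyz
  rw [hr] at hnear
  obtain ⟨w, hw1, hw2⟩ := hnear
  rw [Metric.mem_ball] at hw1 hw2
  have hsep : ∀ u ∈ T.N k, ∀ v ∈ T.N k, u ≠ v → a ^ (-k) ≤ dist u v := by
    rcases le_or_gt 0 k with h | h
    · exact (T.isNet_nonneg k h).2.1
    · exact (T.isNet_neg k h).2.1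
  have hPy := T.P_mem (k + 1) y hy
  have hPz := T.P_mem (k + 1) z hz
  have hn := T.P_nearest (k + 1) z hz _ hPy
  rw [add_sub_cancel_right] at hPy hPz
  by_contra hne
  have h := hsep _ hPz _ hPy hne
  have t1 := dist_triangle_left (T.P (k + 1) z) (T.P (k + 1) y) z
  have t2 := dist_triangle_left z (T.P (k + 1) y) y
  have t3 := dist_triangle_left y (T.P (k + 1) y) w
  linarith
end
end

section
/- In the net tower setup, for every k ∈ ℤ and y ∈ N_k, the closure of the descendant set D_k(y) satisfies the inclusions: closed ball B̄(y, (1−a^{-1})^{-1}·a^{-k}) ⊇ closure(D_k(y)) ⊇ B(y, (2^{-1} − (a−1)^{-1})·a^{-k}). -/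
open Metric Set Filter Topology
open scoped ENNReal

noncomputable section

theorem aux_net_cover {X : Type*} [MetricSpace X] {ε : ℝ} {N Y : Set X} (hε : 0 < ε)
    (h : IsNetIn X ε N Y) {x : X} (hx : x ∈ Y) : ∃ z ∈ N, dist x z < ε := by
  obtain ⟨hNY, hsep, hmax⟩ := h
  by_contra! hcon
  have hM := hmax (insert x N) (Set.subset_insert x N) (Set.insert_subset hx hNY) (by
    intro u hu v hv huv
    rcases hu with rfl | hu <;> rcases hv with rfl | hv
    · exact absurd rfl huv
    · exact hcon v hv
    · rw [dist_comm]; exact hcon u hu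
    · exact hsep u hu v hv huv)
  have hxN : x ∈ N := hM ▸ Set.mem_insert x N
  have := hcon x hxN
  rw [dist_self] at this
  linarith

theorem aux_sep {X : Type*} [MetricSpace X] {a : ℝ} (T : NetTower X a) (k : ℤ) :
    ∀ x ∈ T.N k, ∀ y ∈ T.N k, x ≠ y → a ^ (-k) ≤ dist x y := by
  rcases le_or_gt 0 k with h | h
  · exact (T.isNet_nonneg k h).2.1
  · exact (T.isNet_neg k h).2.1

theorem aux_P_dist {X : Type*} [MetricSpace X] {a : ℝ} (ha : 0 < a) (T : NetTower X a) (l : ℤ)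
    (z : X) (hz : z ∈ T.N l) : dist z (T.P l z) ≤ a ^ (-(l - 1)) := by
  have hpos : 0 < a ^ (-(l - 1)) := zpow_pos ha _
  obtain ⟨w, hw, hzw⟩ : ∃ w ∈ T.N (l - 1), dist z w < a ^ (-(l - 1)) := by
    rcases le_or_gt 0 (l - 1) with h | h
    · exact aux_net_cover hpos (T.isNet_nonneg _ h) (Set.mem_univ z)
    · exact aux_net_cover hpos (T.isNet_neg _ h) (by simpa using hz)
  exact (T.P_nearest l z hz w hw).trans hzw.le

theorem aux_iter {X : Type*} [MetricSpace X] {a : ℝ} (ha : 8 < a) (T : NetTower X a) (j : ℕ) :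
    ∀ (l : ℤ) (z : X), z ∈ T.N l → T.iterP j l z ∈ T.N (l - j) ∧
      dist z (T.iterP j l z) ≤ (1 - a⁻¹)⁻¹ * (a ^ (-(l - j)) - a ^ (-l)) ∧
      T.iterP (j + 1) l z = T.P (l - j) (T.iterP j l z) := by
  have ha0 : (0 : ℝ) < a := by linarith
  have ha1 : (1 - a⁻¹) ≠ 0 := by
    have : a⁻¹ < 1 := inv_lt_one_of_one_lt₀ (by linarith)
    linarith
  induction j with
  | zero => intro l z hz; simp [NetTower.iterP, hz]
  | succ j ih =>
    intro l z hz
    obtain ⟨h1, h2, h3⟩ := ih (l - 1) (T.P l z) (T.P_mem l z hz)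
    have e : l - 1 - (j : ℤ) = l - ((j + 1 : ℕ) : ℤ) := by push_cast; ring
    rw [e] at h1 h2 h3
    refine ⟨h1, ?_, h3⟩
    have h4 := aux_P_dist ha0 T l z hz
    have h5 : a ^ (-l) = a ^ (-(l - 1)) * a⁻¹ := by
      rw [show -l = -(l - 1) - 1 by ring, zpow_sub_one₀ ha0.ne']
    have h6 : (1 - a⁻¹)⁻¹ * (a ^ (-(l - 1)) - a ^ (-l)) = a ^ (-(l - 1)) := by
      rw [h5]
      have ha2 : a - 1 ≠ 0 := by linarith
      field_simp
    have h7 := dist_triangle z (T.P l z) (T.iterP (j + 1) l z)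
    have h8 : T.iterP (j + 1) l z = T.iterP j (l - 1) (T.P l z) := rfl
    rw [h8] at h7 ⊢
    rw [mul_sub] at h2 h6 ⊢
    linarith

/-- Lemma 3.14(c), first part: for every `k ∈ ℤ` and `y ∈ N k`,
`B̄(y,(1−a⁻¹)⁻¹a⁻ᵏ) ⊇ closure(D_k(y)) ⊇ B(y,(2⁻¹−(a−1)⁻¹)a⁻ᵏ)`. -/
theorem netTower_descendants_closure
    (X : Type) [MetricSpace X] [CompleteSpace X]
    (KD KP a : ℝ) (hKD : 1 ≤ KD) (hKP : 1 < KP) (ha : 8 < a)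
    (hdoub : IsDoublingWith X KD) (hperf : IsUniformlyPerfectWith X KP)
    (hdiam : EMetric.diam (Set.univ : Set X) = ENNReal.ofReal (1 / 2) ∨
      EMetric.diam (Set.univ : Set X) = ⊤)
    (T : NetTower X a)
    (k : ℤ) (y : X) (hy : y ∈ T.N k) :
    closure (T.D k y) ⊆ Metric.closedBall y ((1 - a⁻¹)⁻¹ * a ^ (-k)) ∧
      Metric.ball y ((2⁻¹ - (a - 1)⁻¹) * a ^ (-k)) ⊆ closure (T.D k y) := by
  have ha0 : (0 : ℝ) < a := by linarith
  have hinv : a⁻¹ < 1 := inv_lt_one_of_one_lt₀ (by linarith)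
  have hc : 0 < (1 - a⁻¹)⁻¹ := inv_pos.mpr (by linarith)
  have hak : 0 < a ^ (-k) := zpow_pos ha0 _
  constructor
  · apply closure_minimal _ Metric.isClosed_closedBall
    rintro z (rfl | ⟨l, hkl, hz, hzy⟩)
    · exact Metric.mem_closedBall_self (by positivity)
    · obtain ⟨-, h2, -⟩ := aux_iter ha T (l - k).toNat l z hz
      rw [hzy, Int.toNat_of_nonneg (by omega), show l - (l - k) = k by ring] at h2
      have : 0 < a ^ (-l) := zpow_pos ha0 _
      rw [Metric.mem_closedBall]
      refine h2.trans ?_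
      gcongr
      linarith
  · intro x hx
    rw [Metric.mem_closure_iff]
    intro ε hε
    rw [Metric.mem_ball] at hx
    set R := (2⁻¹ - (a - 1)⁻¹) * a ^ (-k) with hR
    obtain ⟨n, hn⟩ : ∃ n : ℕ, a⁻¹ ^ n < min ε (R - dist x y) :=
      exists_pow_lt_of_lt_one (lt_min hε (by linarith)) hinv
    let l : ℤ := max (n : ℤ) (k + 1)
    have hl1 : (n : ℤ) ≤ l := le_max_left _ _
    have hl2 : k + 1 ≤ l := le_max_right _ _
    have hal : 0 < a ^ (-l) := zpow_pos ha0 _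
    have hln : a ^ (-l) ≤ a⁻¹ ^ n := by
      rw [← zpow_natCast, inv_zpow', ]
      exact zpow_le_zpow_right₀ (by linarith) (by omega)
    obtain ⟨z, hz, hxz⟩ := aux_net_cover hal (T.isNet_nonneg l (by omega)) (Set.mem_univ x)
    have hzε : dist x z < ε := by linarith [min_le_left ε (R - dist x y)]
    have hzR : dist x z < R - dist x y := by linarith [min_le_right ε (R - dist x y)]
    refine ⟨z, Or.inr ⟨l, by omega, hz, ?_⟩, hzε⟩
    obtain ⟨j, hj⟩ : ∃ j : ℕ, (j : ℤ) = l - k - 1 := ⟨(l - k - 1).toNat, by omega⟩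
    have hj' : (l - k).toNat = j + 1 := by omega
    obtain ⟨h1, h2, h3⟩ := aux_iter ha T j l z hz
    rw [hj', h3]
    rw [show l - (j : ℤ) = k + 1 by omega] at *
    set w := T.iterP j l z with hw
    have hP := T.P_mem (k + 1) w h1
    have hPn := T.P_nearest (k + 1) w h1 y (by simpa using hy)
    rw [add_sub_cancel_right] at hP
    by_contra hne
    have hs := aux_sep T k _ hP y hy hne
    have e1 : (1 - a⁻¹)⁻¹ * a ^ (-(k + 1)) = (a - 1)⁻¹ * a ^ (-k) := by
      rw [show -(k + 1) = -k - 1 by ring, zpow_sub_one₀ ha0.ne']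
      have : a - 1 ≠ 0 := by linarith
      have : 1 - a⁻¹ ≠ 0 := by linarith
      field_simp
    have e2 : 0 < (1 - a⁻¹)⁻¹ * a ^ (-l) := by positivity
    have t1 := dist_triangle (T.P (k + 1) w) w y
    have t2 := dist_triangle w z y
    have t3 := dist_triangle z x y
    rw [dist_comm (T.P (k + 1) w) w] at t1
    rw [dist_comm w z] at t2
    rw [dist_comm z x] at t3
    rw [mul_sub, e1] at h2
    rw [sub_mul] at hR
    linarith
end
end

section
/- Let (X,d) be a compact, K_P-uniformly perfect metric space with diam(X,d) = 1/2, and let θ be a metric on X that is η-quasisymmetric to d. Let λ ≥ 32, a ≥ 24·max(λ,K_P), and n ≥ 1 be an integer. If B = B(x, 2a^{-n}) and B′ = B(x′, 2a^{-n}) are balls such that B(x, 2λa^{-n}) ∩ B(x′, 2λa^{-n}) ≠ ∅, then K₀^{-1} ≤ diam(B,θ)/diam(B′,θ) ≤ K₀, where K₀ := 2·η(4(λ+2)K_P)·η(8K_P/(λ+2)). -/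
open Metric Set

noncomputable section

/-- `θ` is a metric (distance function) on `X`. -/
def IsMetricOn (X : Type*) (θ : X → X → ℝ) : Prop :=
  (∀ x y : X, 0 ≤ θ x y) ∧ (∀ x y : X, θ x y = 0 ↔ x = y) ∧
    (∀ x y : X, θ x y = θ y x) ∧ ∀ x y z : X, θ x z ≤ θ x y + θ y z

/-- A distortion function: an increasing self-homeomorphism of `[0,∞)`. -/
def IsDistortion (η : ℝ → ℝ) : Prop :=
  StrictMonoOn η (Set.Ici 0) ∧ ContinuousOn η (Set.Ici 0) ∧ η '' Set.Ici 0 = Set.Ici 0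

/-- `θ` is `η`-quasisymmetric to `d`: `θ(x,u)/θ(x,v) ≤ η(d(x,u)/d(x,v))` whenever `x ≠ v`. -/
def QuasisymmetricWith {X : Type*} (η : ℝ → ℝ) (d θ : X → X → ℝ) : Prop :=
  ∀ x u v : X, x ≠ v → θ x u ≤ η (d x u / d x v) * θ x v

/-- Diameter of a set with respect to a distance function. -/
noncomputable def diamWith {X : Type*} (θ : X → X → ℝ) (A : Set X) : ℝ :=
  sSup (Set.image2 θ A A)

/-- Open ball with respect to a distance function. -/
def mball {X : Type*} (θ : X → X → ℝ) (x : X) (r : ℝ) : Set X := {y | θ x y < r}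

lemma diam_aux
    (X : Type) [MetricSpace X] [CompactSpace X]
    (KP lam r : ℝ) (η : ℝ → ℝ) (θ : X → X → ℝ)
    (hKP : 1 < KP) (hperf : IsUniformlyPerfectWith X KP)
    (hdiam : Metric.diam (Set.univ : Set X) = 1 / 2)
    (hη : IsDistortion η) (hθ : IsMetricOn X θ)
    (hqs : QuasisymmetricWith η (fun x y : X => dist x y) θ)
    (hlam : 32 ≤ lam) (hr : 0 < r) (hR : (lam + 2) * r < 1 / 4) (x x' : X)
    (hxx : dist x x' < 2 * lam * r) :
    diamWith θ (Metric.ball x r) ≤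
        2 * η (4 * (lam + 2) * KP) * η (8 * KP / (lam + 2)) * diamWith θ (Metric.ball x' r) := by
  obtain ⟨hmono, -, himg⟩ := hη
  obtain ⟨h0, heq, hsymm, htri⟩ := hθ
  have hle : ∀ s t : ℝ, 0 ≤ s → s ≤ t → η s ≤ η t := fun s t hs hst =>
    hmono.monotoneOn (Set.mem_Ici.2 hs) (Set.mem_Ici.2 (hs.trans hst)) hst
  have hnn : ∀ s : ℝ, 0 ≤ s → 0 ≤ η s := fun s hs => by
    have : η s ∈ η '' Set.Ici 0 := ⟨s, hs, rfl⟩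
    rw [himg] at this
    exact this
  have hKP0 : 0 < KP := by linarith
  have hcompl : ∀ (u : X) (R : ℝ), 0 < R → R < 1 / 4 → ((Metric.ball u R)ᶜ).Nonempty := by
    intro u R hR0 hR1
    by_contra hne
    rw [Set.not_nonempty_iff_eq_empty, Set.compl_empty_iff] at hne
    have := Metric.diam_ball (x := u) hR0.le
    rw [hne, hdiam] at this
    linarith
  have hr4 : r < 1 / 4 := by nlinarith
  have hR0 : 0 < (lam + 2) * r := by nlinarith
  obtain ⟨v, hv1, hv2⟩ := hperf x' r hr (hcompl x' r hr hr4)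
  rw [Metric.mem_ball, dist_comm] at hv1 hv2
  rw [not_lt] at hv2
  have hrK : 0 < r / KP := by positivity
  have hdv : 0 < dist x' v := by linarith
  have hxv : x' ≠ v := dist_pos.1 hdv
  have key : ∀ p : X, dist x' p ≤ 4 * (lam + 2) * r →
      θ x' p ≤ η (4 * (lam + 2) * KP) * θ x' v := by
    intro p hp
    refine (hqs x' p v hxv).trans (mul_le_mul_of_nonneg_right (hle _ _ (by positivity) ?_) (h0 _ _))
    rw [div_le_iff₀ hdv]
    calc dist x' p ≤ 4 * (lam + 2) * r := hp
      _ = 4 * (lam + 2) * KP * (r / KP) := by field_simp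
      _ ≤ _ := mul_le_mul_of_nonneg_left hv2 (by nlinarith)
  have hA : 0 ≤ η (4 * (lam + 2) * KP) := hnn _ (by nlinarith [mul_pos (show 0 < lam + 2 by linarith) hKP0])
  have hB : 0 ≤ η (8 * KP / (lam + 2)) := hnn _ (div_nonneg (by linarith) (by linarith))
  have hbdd : BddAbove (Set.image2 θ (Metric.ball x' r) (Metric.ball x' r)) := by
    refine ⟨2 * (η (4 * (lam + 2) * KP) * θ x' v), ?_⟩
    rintro _ ⟨p, hp, q, hq, rfl⟩
    rw [Metric.mem_ball, dist_comm] at hp hq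
    have h1 := key p (by nlinarith)
    have h2 := key q (by nlinarith)
    have h3 := htri p x' q
    rw [hsymm p x'] at h3
    linarith
  have hlow : θ x' v ≤ diamWith θ (Metric.ball x' r) :=
    le_csSup hbdd ⟨x', Metric.mem_ball_self hr, v, by rwa [Metric.mem_ball, dist_comm], rfl⟩
  refine csSup_le ⟨θ x x, x, Metric.mem_ball_self hr, x, Metric.mem_ball_self hr, rfl⟩ ?_
  rintro _ ⟨p, hp, q, hq, rfl⟩
  obtain ⟨w, hw1, hw2⟩ := hperf p ((lam + 2) * r) hR0 (hcompl p _ hR0 hR)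
  rw [Metric.mem_ball, dist_comm] at hw1 hw2
  rw [not_lt] at hw2
  rw [Metric.mem_ball] at hp hq
  have hRK : 0 < (lam + 2) * r / KP := by positivity
  have hdw : 0 < dist p w := by linarith
  have hx'p : dist x' p ≤ 2 * lam * r + r := by
    have := dist_triangle x' x p
    rw [dist_comm x' x, dist_comm x p] at this
    linarith
  have hlr : 32 * r ≤ lam * r := mul_le_mul_of_nonneg_right hlam hr.le
  have h1 := key p (by linarith)
  have h2 := key w (by linarith [dist_triangle x' p w])
  have h3 := htri p x' w
  rw [hsymm p x'] at h3
  have hpq : dist p q ≤ 2 * r := by linarith [dist_triangle_right p q x]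
  have h4 : θ p q ≤ η (8 * KP / (lam + 2)) * θ p w := by
    refine (hqs p q w (dist_pos.1 hdw)).trans
      (mul_le_mul_of_nonneg_right (hle _ _ (by positivity) ?_) (h0 _ _))
    rw [div_le_iff₀ hdw]
    have hl2 : 0 < lam + 2 := by linarith
    calc dist p q ≤ 8 * r := by linarith
      _ = 8 * KP / (lam + 2) * ((lam + 2) * r / KP) := by field_simp
      _ ≤ _ := mul_le_mul_of_nonneg_left hw2 (by positivity)
  calc θ p q ≤ η (8 * KP / (lam + 2)) * θ p w := h4
    _ ≤ η (8 * KP / (lam + 2)) * (2 * (η (4 * (lam + 2) * KP) * θ x' v)) :=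
        mul_le_mul_of_nonneg_left (by linarith) hB
    _ = 2 * η (4 * (lam + 2) * KP) * η (8 * KP / (lam + 2)) * θ x' v := by ring
    _ ≤ _ := mul_le_mul_of_nonneg_left hlow (by positivity)

/-- Verification of (H2) for the weight `ρ(B) = diam(B,θ)/diam(parent B,θ)` (part of the proof
of Theorem 3.10(b)): if the `λ`-dilates of two level-`n` balls `B = B(x,2a⁻ⁿ)` and
`B′ = B(x′,2a⁻ⁿ)` intersect, then `K₀⁻¹ ≤ diam(B,θ)/diam(B′,θ) ≤ K₀`, with
`K₀ = 2η(4(λ+2)K_P)η(8K_P/(λ+2))`. -/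
theorem diam_comparable_along_horizontal_edges
    (X : Type) [MetricSpace X] [CompactSpace X]
    (KP lam a : ℝ) (η : ℝ → ℝ) (θ : X → X → ℝ)
    (hKP : 1 < KP) (hperf : IsUniformlyPerfectWith X KP)
    (hdiam : Metric.diam (Set.univ : Set X) = 1 / 2)
    (hη : IsDistortion η) (hθ : IsMetricOn X θ)
    (hqs : QuasisymmetricWith η (fun x y : X => dist x y) θ)
    (hlam : 32 ≤ lam) (ha : 24 * max lam KP ≤ a)
    (n : ℕ) (hn : 1 ≤ n) (x x' : X)
    (hmeet : (Metric.ball x (lam * (2 * a ^ (-(n : ℤ)))) ∩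
      Metric.ball x' (lam * (2 * a ^ (-(n : ℤ))))).Nonempty) :
    diamWith θ (Metric.ball x (2 * a ^ (-(n : ℤ)))) ≤
        2 * η (4 * (lam + 2) * KP) * η (8 * KP / (lam + 2)) *
          diamWith θ (Metric.ball x' (2 * a ^ (-(n : ℤ)))) ∧
      diamWith θ (Metric.ball x' (2 * a ^ (-(n : ℤ)))) ≤
        2 * η (4 * (lam + 2) * KP) * η (8 * KP / (lam + 2)) *
          diamWith θ (Metric.ball x (2 * a ^ (-(n : ℤ)))) := by
  have hl : lam ≤ max lam KP := le_max_left _ _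
  have ha1 : 24 * lam ≤ a := by linarith
  have ha0 : 0 < a := by linarith
  have hpos : 0 < a ^ (-(n : ℤ)) := zpow_pos ha0 _
  have hpow : a ^ (-(n : ℤ)) ≤ a⁻¹ := by
    rw [← zpow_neg_one]
    exact zpow_le_zpow_right₀ (by linarith) (by omega)
  have hmul : a ^ (-(n : ℤ)) * (24 * lam) ≤ 1 := by
    calc a ^ (-(n : ℤ)) * (24 * lam) ≤ a⁻¹ * a := by
          apply mul_le_mul hpow ha1 (by linarith) (by positivity)
      _ = 1 := inv_mul_cancel₀ ha0.ne'
  have hR : (lam + 2) * (2 * a ^ (-(n : ℤ))) < 1 / 4 := by nlinarith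
  obtain ⟨z, hz1, hz2⟩ := hmeet
  rw [Metric.mem_ball] at hz1 hz2
  have hxx : dist x x' < 2 * lam * (2 * a ^ (-(n : ℤ))) := by
    linarith [dist_triangle_left x x' z]
  exact ⟨diam_aux X KP lam _ η θ hKP hperf hdiam hη hθ hqs hlam (by positivity) hR x x' hxx,
    diam_aux X KP lam _ η θ hKP hperf hdiam hη hθ hqs hlam (by positivity) hR x' x
      (by rwa [dist_comm])⟩
end
end

section
/- Let (X,d) be a compact, K_P-uniformly perfect metric space with diam(X,d) = 1/2, and let θ be a metric on X that is η-quasisymmetric to d. Let λ ≥ 32, a ≥ 24·max(λ,K_P), and n ≥ 1 be an integer. Let B₁,…,B_m (m ∈ ℕ) be balls of radius 2a^{-n} in (X,d) such that B(x_{B_i}, 2λa^{-n}) ∩ B(x_{B_{i+1}}, 2λa^{-n}) ≠ ∅ for all 1 ≤ i ≤ m−1, where x_{B_i} denotes the center of B_i. Then for every x ∈ B₁ and y ∈ B_m, θ(x,y) ≤ 2·η(2λK_P)·Σ_{i=1}^{m} diam(B_i,θ). -/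
open Metric Set
open scoped BigOperators

noncomputable section

/-- Chain estimate (part of the proof of (H3) in Theorem 3.10(b)): if `B₁,…,B_m` are balls of
radius `2a⁻ⁿ` whose consecutive `λ`-dilates intersect, then for `x ∈ B₁` and `y ∈ B_m`,
`θ(x,y) ≤ 2η(2λK_P)·Σᵢ diam(Bᵢ,θ)`. -/
theorem chain_of_balls_estimate
    (X : Type) [MetricSpace X] [CompactSpace X]
    (KP lam a : ℝ) (η : ℝ → ℝ) (θ : X → X → ℝ)
    (hKP : 1 < KP) (hperf : IsUniformlyPerfectWith X KP)
    (hdiam : Metric.diam (Set.univ : Set X) = 1 / 2)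
    (hη : IsDistortion η) (hθ : IsMetricOn X θ)
    (hqs : QuasisymmetricWith η (fun x y : X => dist x y) θ)
    (hlam : 32 ≤ lam) (ha : 24 * max lam KP ≤ a)
    (n : ℕ) (hn : 1 ≤ n) (m : ℕ) (hm : 1 ≤ m) (c : ℕ → X)
    (hchain : ∀ i : ℕ, i + 1 < m →
      (Metric.ball (c i) (lam * (2 * a ^ (-(n : ℤ)))) ∩
        Metric.ball (c (i + 1)) (lam * (2 * a ^ (-(n : ℤ))))).Nonempty)
    (x y : X)
    (hx : dist x (c 0) < 2 * a ^ (-(n : ℤ)))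
    (hy : dist y (c (m - 1)) < 2 * a ^ (-(n : ℤ))) :
    θ x y ≤ 2 * η (2 * lam * KP) *
      ∑ i ∈ Finset.range m, diamWith θ (Metric.ball (c i) (2 * a ^ (-(n : ℤ)))) := by
  obtain ⟨hpos, hzero, hsymm, htri⟩ := hθ
  obtain ⟨hmono, -, -⟩ := hη
  have hl1 := le_max_left lam KP
  have ha1 : 768 ≤ a := by linarith
  have ha0 : 0 < a := by linarith
  set r : ℝ := 2 * a ^ (-(n : ℤ)) with hr
  have hr0 : 0 < r := by positivity
  have hr1 : r ≤ 2 / 768 := by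
    have h1 : a ^ 1 ≤ a ^ n := pow_le_pow_right₀ (by linarith) hn
    have h2 : (a ^ n)⁻¹ ≤ (768 : ℝ)⁻¹ := inv_anti₀ (by norm_num) (by linarith)
    rw [hr, zpow_neg, zpow_natCast]
    linarith
  have hKP0 : 0 < KP := by linarith
  -- points in each ball away from the centre
  have hv : ∀ p : X, ∃ v, dist p v < r ∧ r / KP ≤ dist p v := by
    intro p
    have hne : ((Metric.ball p r)ᶜ).Nonempty := by
      rw [Set.nonempty_compl]
      intro h
      have h1 : Metric.diam (Metric.ball p r) ≤ 2 * r := Metric.diam_ball hr0.le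
      rw [h, hdiam] at h1
      linarith
    obtain ⟨v, hv1, hv2⟩ := hperf p r hr0 hne
    rw [Metric.mem_ball, dist_comm] at hv1
    rw [Metric.mem_ball, dist_comm, not_lt] at hv2
    exact ⟨v, hv1, hv2⟩
  choose v hv1 hv2 using hv
  have hv0 : ∀ p, 0 < dist p (v p) := fun p => lt_of_lt_of_le (by positivity) (hv2 p)
  set H := η (2 * lam * KP) with hH
  have hLK : 0 < lam * KP := by positivity
  have hLK1 : 1 ≤ lam * KP := by nlinarith
  have hle : ∀ t, 0 ≤ t → t ≤ 2 * lam * KP → η t ≤ H := fun t h0 h1 =>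
    hmono.monotoneOn h0 (show (0:ℝ) ≤ 2 * lam * KP by linarith) h1
  have hθv : ∀ p, 0 < θ p (v p) := fun p => lt_of_le_of_ne (hpos _ _) (fun h => by
    have := (hzero _ _).1 h.symm
    exact (dist_pos.1 (hv0 p)) this)
  have hH1 : 1 ≤ H := by
    have h := hqs x (v x) (v x) (dist_pos.1 (hv0 x))
    simp only [div_self (hv0 x).ne'] at h
    have h2 := hθv x
    have h3 : 1 ≤ η 1 := by
      by_contra hc
      push Not at hc
      nlinarith
    exact h3.trans (hle 1 (by norm_num) (by linarith))
  have hkey : ∀ p z, dist p z < lam * r → θ p z ≤ H * θ p (v p) := by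
    intro p z hz
    refine (hqs p z (v p) (dist_pos.1 (hv0 p))).trans ?_
    refine mul_le_mul_of_nonneg_right (hle _ (by positivity) ?_) (hpos _ _)
    rw [div_le_iff₀ (hv0 p)]
    have h1 : lam * r = lam * KP * (r / KP) := by field_simp
    have h2 : lam * KP * (r / KP) ≤ lam * KP * dist p (v p) :=
      mul_le_mul_of_nonneg_left (hv2 p) hLK.le
    nlinarith [mul_pos hLK (hv0 p)]
  have hrl : r ≤ lam * r := by nlinarith
  have hD : ∀ p u w, dist p u < r → dist p w < r → θ u w ≤ diamWith θ (Metric.ball p r) := by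
    intro p u w hu hw
    refine le_csSup ⟨2 * (H * θ p (v p)), ?_⟩
      (Set.mem_image2_of_mem (by rwa [Metric.mem_ball, dist_comm])
        (by rwa [Metric.mem_ball, dist_comm]))
    rintro _ ⟨s, hs, t, ht, rfl⟩
    rw [Metric.mem_ball, dist_comm] at hs ht
    have h1 := hkey p s (by linarith)
    have h2 := hkey p t (by linarith)
    have h3 := htri s p t
    rw [hsymm s p] at h3
    linarith
  have hkey2 : ∀ p z, dist p z < lam * r → θ p z ≤ H * diamWith θ (Metric.ball p r) := by
    intro p z hz
    refine (hkey p z hz).trans (mul_le_mul_of_nonneg_left ?_ (by linarith))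
    exact hD p p (v p) (by simpa using hr0) (hv1 p)
  have hx' : dist (c 0) x < lam * r := by rw [dist_comm]; linarith
  have hy' : dist (c (m - 1)) y < lam * r := by rw [dist_comm]; linarith
  have hind : ∀ k, k < m → θ x (c k) ≤
      2 * H * ∑ i ∈ Finset.range k, diamWith θ (Metric.ball (c i) r)
        + H * diamWith θ (Metric.ball (c k) r) := by
    intro k
    induction k with
    | zero =>
      intro _
      rw [hsymm]
      simpa using hkey2 (c 0) x hx'
    | succ k ih =>
      intro hk
      obtain ⟨z, hz1, hz2⟩ := hchain k hk
      rw [Metric.mem_ball, dist_comm] at hz1 hz2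
      have h1 := hkey2 _ _ hz1
      have h2 := hkey2 _ _ hz2
      have h3 := ih (by omega)
      have h4 := htri x (c k) (c (k + 1))
      have h5 := htri (c k) z (c (k + 1))
      rw [hsymm z] at h5
      rw [Finset.sum_range_succ, mul_add]
      linarith
  have h1 := hind (m - 1) (by omega)
  have h2 := hkey2 _ _ hy'
  have h3 := htri x (c (m - 1)) y
  obtain ⟨k, rfl⟩ : ∃ k, m = k + 1 := ⟨m - 1, by omega⟩
  simp only [Nat.add_sub_cancel] at h1 h2 h3
  rw [Finset.sum_range_succ, mul_add]
  linarith
end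
end

section
/- Fix an integer n ≥ 2 and a real t > 0. Let m be Lebesgue measure on ℝⁿ and let μ be the measure dμ = |x₁|^t dm, where x₁ denotes the first coordinate. For x ≠ y in ℝⁿ define h(x,y) := ( μ(B(x,|x−y|)) · |x−y|² / m(B(x,|x−y|)) )^{1/2}, where B(x,r) is the open Euclidean ball, set h(x,x) := 0 and h̃(x,y) := min(h(x,y), h(y,x)), and let d_h(x,y) := inf{ Σ_{i=0}^{N−1} h̃(x_i,x_{i+1}) : N ∈ ℕ, x₀ = x, x_N = y, x₁,…,x_{N−1} ∈ ℝⁿ } be the maximal semimetric induced by h. Then d_h(p,q) = 0 for p = (0,…,0) and q = (0,…,0,1). -/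
open Metric Set MeasureTheory
open scoped BigOperators ENNReal

noncomputable section

lemma h_bound_aux (n : ℕ) (i : Fin n) (t : ℝ) (ht : 0 < t) (x : EuclideanSpace ℝ (Fin n))
    (hx : x i = 0) (r : ℝ) (hr : 0 ≤ r) :
    Real.sqrt ((((volume : Measure (EuclideanSpace ℝ (Fin n))).withDensity
      fun x => ENNReal.ofReal (|x i| ^ t)) (Metric.ball x r)).toReal * r ^ 2 /
        (volume (Metric.ball x r)).toReal) ≤ r * Real.sqrt (r ^ t) := by
  have hfin : volume (Metric.ball x r) ≠ ⊤ := measure_ball_lt_top.ne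
  have hrt : 0 ≤ r ^ t := Real.rpow_nonneg hr t
  have h1 : ((volume : Measure (EuclideanSpace ℝ (Fin n))).withDensity
      fun x => ENNReal.ofReal (|x i| ^ t)) (Metric.ball x r)
      ≤ ENNReal.ofReal (r ^ t) * volume (Metric.ball x r) := by
    rw [withDensity_apply _ measurableSet_ball, ← setLIntegral_const]
    refine setLIntegral_mono measurable_const fun y hy => ?_
    apply ENNReal.ofReal_le_ofReal
    apply Real.rpow_le_rpow (abs_nonneg _) _ ht.le
    have h2 := PiLp.norm_apply_le (y - x) i
    rw [mem_ball, dist_eq_norm] at hy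
    simp only [PiLp.sub_apply, hx, sub_zero, Real.norm_eq_abs] at h2
    linarith
  have h3 := ENNReal.toReal_mono (ENNReal.mul_ne_top ENNReal.ofReal_ne_top hfin) h1
  rw [ENNReal.toReal_mul, ENNReal.toReal_ofReal hrt] at h3
  have h4 : r * Real.sqrt (r ^ t) = Real.sqrt (r ^ t * r ^ 2) := by
    rw [Real.sqrt_mul hrt, Real.sqrt_sq hr, mul_comm]
  rw [h4]
  apply Real.sqrt_le_sqrt
  apply div_le_of_le_mul₀ ENNReal.toReal_nonneg (by positivity)
  nlinarith [mul_le_mul_of_nonneg_right h3 (sq_nonneg r)]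

/-- Example 4.6: on `ℝⁿ` (`n ≥ 2`) with Lebesgue measure `m` and the weighted measure
`dμ = |x₁|^t dm` (`t > 0`), the maximal semimetric `d_h` induced by
`h(x,y) = (μ(B(x,|x−y|))·|x−y|²/m(B(x,|x−y|)))^{1/2}` degenerates:
`d_h((0,…,0),(0,…,0,1)) = 0`. -/
theorem weighted_maximal_semimetric_degenerates
    (n : ℕ) (hn : 2 ≤ n) (t : ℝ) (ht : 0 < t) :
    let μ : Measure (EuclideanSpace ℝ (Fin n)) :=
      volume.withDensity fun x => ENNReal.ofReal (|x ⟨0, by omega⟩| ^ t)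
    let h : EuclideanSpace ℝ (Fin n) → EuclideanSpace ℝ (Fin n) → ℝ := fun x y =>
      Real.sqrt ((μ (Metric.ball x (dist x y))).toReal * dist x y ^ 2 /
        (volume (Metric.ball x (dist x y))).toReal)
    let htil : EuclideanSpace ℝ (Fin n) → EuclideanSpace ℝ (Fin n) → ℝ := fun x y =>
      min (h x y) (h y x)
    let dh : EuclideanSpace ℝ (Fin n) → EuclideanSpace ℝ (Fin n) → ℝ := fun x y =>
      sInf {s : ℝ | ∃ (N : ℕ) (c : ℕ → EuclideanSpace ℝ (Fin n)),
        c 0 = x ∧ c N = y ∧ s = ∑ i ∈ Finset.range N, htil (c i) (c (i + 1))}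
    dh 0 (EuclideanSpace.single ⟨n - 1, by omega⟩ 1) = 0 := by
  intro μ h htil dh
  have hnn : ∀ x y, 0 ≤ htil x y := fun x y => le_min (Real.sqrt_nonneg _) (Real.sqrt_nonneg _)
  have hbdd : BddBelow {s : ℝ | ∃ (N : ℕ) (c : ℕ → EuclideanSpace ℝ (Fin n)),
        c 0 = 0 ∧ c N = (EuclideanSpace.single ⟨n - 1, by omega⟩ 1) ∧
        s = ∑ i ∈ Finset.range N, htil (c i) (c (i + 1))} := by
    refine ⟨0, ?_⟩
    rintro s ⟨N, c, -, -, rfl⟩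
    exact Finset.sum_nonneg fun i _ => hnn _ _
  have key : ∀ N : ℕ, dh 0 (EuclideanSpace.single ⟨n - 1, by omega⟩ 1) ≤
      Real.sqrt ((1 / ((N : ℝ) + 1)) ^ t) := by
    intro N
    have hN : (0 : ℝ) < (N : ℝ) + 1 := by positivity
    let c : ℕ → EuclideanSpace ℝ (Fin n) := fun k =>
      EuclideanSpace.single ⟨n - 1, by omega⟩ ((k : ℝ) / ((N : ℝ) + 1))
    have hd : ∀ k, dist (c k) (c (k + 1)) = 1 / ((N : ℝ) + 1) := by
      intro k
      simp only [c, EuclideanSpace.dist_single_same, Real.dist_eq]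
      rw [← sub_div, abs_div, abs_of_pos hN]
      simp
    have hle : dh 0 (EuclideanSpace.single ⟨n - 1, by omega⟩ 1) ≤
        ∑ i ∈ Finset.range (N + 1), htil (c i) (c (i + 1)) := by
      refine csInf_le hbdd ⟨N + 1, c, ?_, ?_, rfl⟩
      · simp [c]
      · simp only [c]
        push_cast
        rw [div_self hN.ne']
    refine hle.trans ?_
    have hterm : ∀ i ∈ Finset.range (N + 1), htil (c i) (c (i + 1)) ≤
        1 / ((N : ℝ) + 1) * Real.sqrt ((1 / ((N : ℝ) + 1)) ^ t) := by
      intro k _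
      refine (min_le_left _ _).trans ?_
      have hb := h_bound_aux n ⟨0, by omega⟩ t ht (c k) (by
        have : (⟨0, by omega⟩ : Fin n) ≠ ⟨n - 1, by omega⟩ := by
          intro he
          have := congrArg Fin.val he
          simp at this
          omega
        simp [c, this]) (dist (c k) (c (k + 1))) dist_nonneg
      rw [← hd k]
      exact hb
    refine (Finset.sum_le_sum hterm).trans (le_of_eq ?_)
    rw [Finset.sum_const, Finset.card_range, nsmul_eq_mul]
    push_cast
    field_simp
  apply le_antisymm
  · have hlim : Filter.Tendsto (fun N : ℕ => Real.sqrt ((1 / ((N : ℝ) + 1)) ^ t))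
        Filter.atTop (nhds 0) := by
      have h1 := (tendsto_one_div_add_atTop_nhds_zero_nat (𝕜 := ℝ)).rpow_const
        (p := t) (Or.inr ht.le)
      rw [Real.zero_rpow ht.ne'] at h1
      simpa using h1.sqrt
    exact ge_of_tendsto' hlim key
  · apply Real.sInf_nonneg
    rintro s ⟨N, c, -, -, rfl⟩
    exact Finset.sum_nonneg fun i _ => hnn _ _
end
end
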